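/- arXiv:2112.02207 — 7 statements merged into one kernel-verified Lean document; each statement's English description precedes it below -/
import Mathlib

section
/- Let E = EuclideanSpace ℝ (Fin 2) and n ≥ 1. Let L : Fin n → (affine subspaces of E) be lines in ℝ², let u : Fin n → E with u k a nonzero vector in (L k).direction for each k, and let v : Fin n → E be nonzero vectors with v k ∉ (L k).direction for each k. Let F : Fin n → (E → E) satisfy: for every k and every x ∈ E, F k x ∈ L k and F k x - x ∈ ℝ ∙ (v k) (each F k is the oblique projection of the plane onto the line L k along the direction v k). If ∏_{k=0}^{n-1} ( Real.sin (angle (u (k-1)) (v k)) / Real.sin (angle (u k) (v k)) ) < 1 (index k−1 taken cyclically in Fin n), then the composite map G = F (n-1) ∘ ⋯ ∘ F 1 ∘ F 0 : E → E has a unique fixed point. -/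
/-- The standard area form on the Euclidean plane. -/
noncomputable def planeArea :
    EuclideanSpace ℝ (Fin 2) →ₗ[ℝ] EuclideanSpace ℝ (Fin 2) →ₗ[ℝ] ℝ :=
  LinearMap.mk₂ ℝ (fun a b => a 0 * b 1 - a 1 * b 0)
    (by intros; simp; ring) (by intros; simp; ring)
    (by intros; simp; ring) (by intros; simp; ring)

lemma planeArea_apply (a b : EuclideanSpace ℝ (Fin 2)) :
    planeArea a b = a 0 * b 1 - a 1 * b 0 := rfl

lemma planeArea_self (a : EuclideanSpace ℝ (Fin 2)) : planeArea a a = 0 := by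
  rw [planeArea_apply]; ring

lemma abs_planeArea (a b : EuclideanSpace ℝ (Fin 2)) :
    |planeArea a b| = Real.sin (InnerProductGeometry.angle a b) * (‖a‖ * ‖b‖) := by
  rw [InnerProductGeometry.sin_angle_mul_norm_mul_norm, ← Real.sqrt_sq_eq_abs, planeArea_apply]
  congr 1
  simp only [PiLp.inner_apply, Fin.sum_univ_two, RCLike.inner_apply, conj_trivial]
  ring

lemma planeArea_ne_zero {a b : EuclideanSpace ℝ (Fin 2)} (ha : a ≠ 0)
    (hb : b ∉ Submodule.span ℝ {a}) : planeArea a b ≠ 0 := by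
  intro h
  rw [planeArea_apply] at h
  apply hb
  rw [Submodule.mem_span_singleton]
  by_cases h0 : a 0 = 0
  · have h1 : a 1 ≠ 0 := by
      intro h1
      apply ha
      ext i
      fin_cases i <;> simp [h0, h1]
    refine ⟨b 1 / a 1, ?_⟩
    ext i
    fin_cases i
    · simp only [Fin.zero_eta, PiLp.smul_apply, smul_eq_mul]
      field_simp
      linarith
    · simp [h1]
  · refine ⟨b 0 / a 0, ?_⟩
    ext i
    fin_cases i
    · simp [h0]
    · simp only [Fin.mk_one, PiLp.smul_apply, smul_eq_mul]
      field_simp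
      linarith

/-- The difference of two values of the oblique projection onto a line with direction `u`
along `v`. -/
lemma oblique_projection_sub {f : EuclideanSpace ℝ (Fin 2) → EuclideanSpace ℝ (Fin 2)}
    {u v : EuclideanSpace ℝ (Fin 2)} (huv : planeArea u v ≠ 0)
    (hu : ∀ x y, f x - f y ∈ Submodule.span ℝ {u})
    (hv : ∀ x, f x - x ∈ Submodule.span ℝ {v}) (x y : EuclideanSpace ℝ (Fin 2)) :
    f x - f y = (planeArea (x - y) v / planeArea u v) • u := by
  obtain ⟨c, hc⟩ := Submodule.mem_span_singleton.1 (hu x y)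
  obtain ⟨s, hs⟩ := Submodule.mem_span_singleton.1 (hv x)
  obtain ⟨t, ht⟩ := Submodule.mem_span_singleton.1 (hv y)
  have hxy : x - y = c • u - (s - t) • v := by
    rw [sub_smul, hc, hs, ht]; abel
  have harea : planeArea (x - y) v = c * planeArea u v := by
    rw [hxy]; simp [planeArea_self]
  rw [harea, mul_div_cancel_right₀ _ huv, hc]

lemma foldl_oblique_projection_sub (m : ℕ) (u v : Fin (m + 1) → EuclideanSpace ℝ (Fin 2))
    (F : Fin (m + 1) → (EuclideanSpace ℝ (Fin 2) → EuclideanSpace ℝ (Fin 2)))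
    (hF : ∀ k x y, F k x - F k y = (planeArea (x - y) (v k) / planeArea (u k) (v k)) • u k)
    (x y : EuclideanSpace ℝ (Fin 2)) :
    ((List.ofFn F).foldl (fun g f => f ∘ g) id) x
        - ((List.ofFn F).foldl (fun g f => f ∘ g) id) y =
      (planeArea (x - y) (v 0) * ((planeArea (u 0) (v 0))⁻¹ * ∏ i : Fin m,
        (planeArea (u i.castSucc) (v i.succ) / planeArea (u i.succ) (v i.succ)))) •
          u (Fin.last m) := by
  induction m with
  | zero => simpa [div_eq_mul_inv] using hF 0 x y
  | succ m ih =>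
    have h := ih (fun i => u i.castSucc) (fun i => v i.castSucc) (fun i => F i.castSucc)
      (fun k => hF k.castSucc)
    rw [List.ofFn_succ', List.concat_eq_append, List.foldl_append]
    simp only [List.foldl_cons, List.foldl_nil, Function.comp_apply]
    rw [hF, h, Fin.prod_univ_castSucc]
    simp only [map_smul, LinearMap.smul_apply, smul_eq_mul, Fin.castSucc_zero, Fin.succ_last,
      Fin.succ_castSucc]
    congr 1
    ring

/-- A rank-one affine map of the form `G x = G y + φ (x - y) • w` has a unique fixed point
as soon as `φ w ≠ 1`. -/
lemma existsUnique_fixed_point_of_sub_eq_smul {E : Type*} [AddCommGroup E] [Module ℝ E]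
    {G : E → E} {φ : E →ₗ[ℝ] ℝ} {w : E} (hG : ∀ x y, G x - G y = φ (x - y) • w)
    (hw : φ w ≠ 1) : ∃! p, G p = p := by
  have hw' : 1 - φ w ≠ 0 := sub_ne_zero.2 hw.symm
  refine ⟨G 0 + (φ (G 0) / (1 - φ w)) • w, ?_, fun q hq => ?_⟩
  · have h := hG (G 0 + (φ (G 0) / (1 - φ w)) • w) 0
    have ht : φ (G 0 + (φ (G 0) / (1 - φ w)) • w - 0) = φ (G 0) / (1 - φ w) := by
      simp only [sub_zero, map_add, map_smul, smul_eq_mul]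
      field_simp
      ring
    rw [ht] at h
    exact sub_eq_iff_eq_add'.1 h
  · have h := hG q 0
    rw [hq, sub_zero] at h
    have hφ := congrArg φ h
    rw [map_sub, map_smul, smul_eq_mul] at hφ
    have hq' : φ q = φ (G 0) / (1 - φ w) := by
      rw [eq_div_iff hw']
      linarith
    rw [← hq']
    exact sub_eq_iff_eq_add'.1 h

/-- Passing from sines to areas does not change the absolute value of the cyclic product, since
the norms cancel. -/
lemma abs_prod_planeArea_div {n : ℕ} [NeZero n] {u v : Fin n → EuclideanSpace ℝ (Fin 2)}
    (hu : ∀ k, u k ≠ 0) (hv : ∀ k, v k ≠ 0) :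
    |∏ k, planeArea (u (k - 1)) (v k) / planeArea (u k) (v k)| =
      ∏ k, Real.sin (InnerProductGeometry.angle (u (k - 1)) (v k)) /
        Real.sin (InnerProductGeometry.angle (u k) (v k)) := by
  have hnorm : ∏ k, ‖u (k - 1)‖ = ∏ k, ‖u k‖ :=
    (Equiv.subRight (1 : Fin n)).prod_comp fun k => ‖u k‖
  have hu' : ∏ k, ‖u k‖ ≠ 0 := Finset.prod_ne_zero_iff.2 fun k _ => norm_ne_zero_iff.2 (hu k)
  have hv' : ∏ k, ‖v k‖ ≠ 0 := Finset.prod_ne_zero_iff.2 fun k _ => norm_ne_zero_iff.2 (hv k)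
  simp only [Finset.abs_prod, abs_div, abs_planeArea, Finset.prod_div_distrib,
    Finset.prod_mul_distrib, hnorm]
  exact mul_div_mul_right _ _ (mul_ne_zero hu' hv')

/-- Concrete form of Theorem 2 of the paper: if each `F k` is the oblique
projection of the plane onto the line `L k` along the direction `v k`, and the
product of the similarity coefficients `sin(angle (u (k-1)) (v k)) / sin(angle (u k) (v k))`
is less than `1`, then the cyclic composite `F (n-1) ∘ ⋯ ∘ F 0` has a unique
fixed point. -/
theorem exists_unique_fixed_point_of_rule_composition
    (n : ℕ) [NeZero n] (hn : 1 ≤ n)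
    (L : Fin n → AffineSubspace ℝ (EuclideanSpace ℝ (Fin 2)))
    (hLne : ∀ k, (L k : Set (EuclideanSpace ℝ (Fin 2))).Nonempty)
    (hLdim : ∀ k, Module.finrank ℝ (L k).direction = 1)
    (u : Fin n → EuclideanSpace ℝ (Fin 2))
    (hu : ∀ k, u k ∈ (L k).direction) (hu0 : ∀ k, u k ≠ 0)
    (v : Fin n → EuclideanSpace ℝ (Fin 2))
    (hv0 : ∀ k, v k ≠ 0) (hv : ∀ k, v k ∉ (L k).direction)
    (F : Fin n → (EuclideanSpace ℝ (Fin 2) → EuclideanSpace ℝ (Fin 2)))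
    (hF : ∀ k x, F k x ∈ L k ∧ F k x - x ∈ Submodule.span ℝ {v k})
    (hC : ∏ k : Fin n,
      (Real.sin (InnerProductGeometry.angle (u (k - 1)) (v k)) /
        Real.sin (InnerProductGeometry.angle (u k) (v k))) < 1) :
    ∃! p : EuclideanSpace ℝ (Fin 2),
      ((List.ofFn F).foldl (fun g f => f ∘ g) id) p = p := by
  obtain ⟨m, rfl⟩ : ∃ m, n = m + 1 := ⟨n - 1, by omega⟩
  have hspan : ∀ k, (L k).direction = Submodule.span ℝ {u k} := by
    intro k
    refine le_antisymm (fun w hw => ?_) ((Submodule.span_singleton_le_iff_mem _ _).2 (hu k))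
    have hne : (⟨u k, hu k⟩ : (L k).direction) ≠ 0 := fun h => hu0 k (congrArg Subtype.val h)
    obtain ⟨c, hc⟩ := (finrank_eq_one_iff_of_nonzero' _ hne).1 (hLdim k) ⟨w, hw⟩
    exact Submodule.mem_span_singleton.2 ⟨c, congrArg Subtype.val hc⟩
  have hproj : ∀ k x y,
      F k x - F k y = (planeArea (x - y) (v k) / planeArea (u k) (v k)) • u k := by
    intro k
    refine oblique_projection_sub (planeArea_ne_zero (hu0 k) (hspan k ▸ hv k)) (fun x y => ?_)
      fun x => (hF k x).2
    rw [← hspan k]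
    exact AffineSubspace.vsub_mem_direction (hF k x).1 (hF k y).1
  refine existsUnique_fixed_point_of_sub_eq_smul (φ := planeArea.flip (v 0))
    (w := ((planeArea (u 0) (v 0))⁻¹ * ∏ i : Fin m,
      (planeArea (u i.castSucc) (v i.succ) / planeArea (u i.succ) (v i.succ))) • u (Fin.last m))
    (fun x y => ?_) (fun h => ?_)
  · rw [foldl_oblique_projection_sub m u v F hproj, smul_smul, LinearMap.flip_apply]
  · have hprod : ∏ k, planeArea (u (k - 1)) (v k) / planeArea (u k) (v k) = 1 := by
      have hlast : (0 : Fin (m + 1)) - 1 = Fin.last m := by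
        rw [sub_eq_iff_eq_add, Fin.last_add_one]
      have hsucc : ∀ i : Fin m, i.succ - 1 = i.castSucc := fun i => by
        rw [sub_eq_iff_eq_add, Fin.coeSucc_eq_succ]
      rw [Fin.prod_univ_succ, ← h]
      simp only [hlast, hsucc, LinearMap.flip_apply, map_smul, smul_eq_mul]
      ring
    rw [← abs_prod_planeArea_div hu0 hv0, hprod, abs_one] at hC
    exact lt_irrefl _ hC
end

section
/- Let L₁ and L₂ be lines in ℝ² with nonzero direction vectors u ∈ L₁.direction and w ∈ L₂.direction, and let v be a nonzero vector with v ∉ L₂.direction. Then for all points x, y ∈ L₁ and x', y' ∈ L₂ such that x' - x ∈ ℝ ∙ v and y' - y ∈ ℝ ∙ v, one has dist x' y' = ( Real.sin (angle u v) / Real.sin (angle w v) ) * dist x y. In particular, the oblique projection from L₁ onto L₂ along direction v is a similarity transformation with similarity coefficient c = sin(angle u v)/sin(angle w v) ≥ 0. -/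
open InnerProductGeometry in
/-- The distance from `p` to the line `ℝ ∙ v` is unchanged by adding a multiple of `v` to `p`. -/
theorem norm_mul_sin_angle_add_smul {V : Type*} [NormedAddCommGroup V] [InnerProductSpace ℝ V]
    (p : V) {v : V} (hv : v ≠ 0) (t : ℝ) :
    ‖p + t • v‖ * Real.sin (angle (p + t • v) v) = ‖p‖ * Real.sin (angle p v) := by
  have hv' : ‖v‖ ≠ 0 := norm_ne_zero_iff.mpr hv
  have h₁ := sin_angle_mul_norm_mul_norm (p + t • v) v
  have h₂ := sin_angle_mul_norm_mul_norm p v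
  have h₃ : inner ℝ (p + t • v) (p + t • v) * inner ℝ v v -
      inner ℝ (p + t • v) v * inner ℝ (p + t • v) v =
      inner ℝ p p * inner ℝ v v - inner ℝ p v * inner ℝ p v := by
    simp only [inner_add_left, inner_add_right, real_inner_smul_left, real_inner_smul_right,
      real_inner_comm p v]
    ring
  rw [h₃, ← h₂] at h₁
  apply mul_right_cancel₀ hv'
  linarith

open InnerProductGeometry in
theorem norm_smul_mul_sin_angle_smul {V : Type*} [NormedAddCommGroup V] [InnerProductSpace ℝ V]
    (u v : V) (a : ℝ) :
    ‖a • u‖ * Real.sin (angle (a • u) v) = ‖a • u‖ * Real.sin (angle u v) := by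
  rcases lt_trichotomy a 0 with ha | rfl | ha
  · rw [angle_smul_left_of_neg _ _ ha, angle_neg_left, Real.sin_pi_sub]
  · simp
  · rw [angle_smul_left_of_pos _ _ ha]

open InnerProductGeometry in
theorem sin_angle_ne_zero_of_notMem {V : Type*} [NormedAddCommGroup V] [InnerProductSpace ℝ V]
    {S : Submodule ℝ V} {w v : V} (hw : w ∈ S) (hv : v ∉ S) :
    Real.sin (angle w v) ≠ 0 := by
  intro h
  rcases sin_eq_zero_iff_angle_eq_zero_or_angle_eq_pi.mp h with h | h
  · obtain ⟨-, r, -, rfl⟩ := angle_eq_zero_iff.mp h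
    exact hv (S.smul_mem r hw)
  · obtain ⟨-, r, -, rfl⟩ := angle_eq_pi_iff.mp h
    exact hv (S.smul_mem r hw)

theorem exists_smul_eq_of_mem_of_finrank_eq_one {V : Type*} [AddCommGroup V] [Module ℝ V]
    {S : Submodule ℝ V} (hS : Module.finrank ℝ S = 1) {u p : V} (hu : u ∈ S) (hu0 : u ≠ 0)
    (hp : p ∈ S) : ∃ a : ℝ, a • u = p := by
  obtain ⟨a, ha⟩ := exists_smul_eq_of_finrank_eq_one hS
    (x := (⟨u, hu⟩ : S)) (by simpa using hu0) ⟨p, hp⟩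
  exact ⟨a, congrArg Subtype.val ha⟩

/-- The law-of-sines computation of Section 2.1 of the paper: the oblique
projection from the line `L₁` onto the line `L₂` along the direction `v` is a
similarity with coefficient `sin(angle u v) / sin(angle w v)`. -/
theorem oblique_projection_is_similarity
    (L₁ L₂ : AffineSubspace ℝ (EuclideanSpace ℝ (Fin 2)))
    (h₁ne : (L₁ : Set (EuclideanSpace ℝ (Fin 2))).Nonempty)
    (h₁dim : Module.finrank ℝ L₁.direction = 1)
    (h₂ne : (L₂ : Set (EuclideanSpace ℝ (Fin 2))).Nonempty)
    (h₂dim : Module.finrank ℝ L₂.direction = 1)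
    (u w v : EuclideanSpace ℝ (Fin 2))
    (hu : u ∈ L₁.direction) (hu0 : u ≠ 0)
    (hw : w ∈ L₂.direction) (hw0 : w ≠ 0)
    (hv0 : v ≠ 0) (hv : v ∉ L₂.direction)
    (x y x' y' : EuclideanSpace ℝ (Fin 2))
    (hx : x ∈ L₁) (hy : y ∈ L₁) (hx' : x' ∈ L₂) (hy' : y' ∈ L₂)
    (hxx' : x' - x ∈ Submodule.span ℝ {v})
    (hyy' : y' - y ∈ Submodule.span ℝ {v}) :
    dist x' y' = (Real.sin (InnerProductGeometry.angle u v) /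
      Real.sin (InnerProductGeometry.angle w v)) * dist x y := by
  obtain ⟨a, ha⟩ := exists_smul_eq_of_mem_of_finrank_eq_one h₁dim hu hu0
    (L₁.vsub_mem_direction hx hy)
  obtain ⟨b, hb⟩ := exists_smul_eq_of_mem_of_finrank_eq_one h₂dim hw hw0
    (L₂.vsub_mem_direction hx' hy')
  obtain ⟨t, ht⟩ := Submodule.mem_span_singleton.mp (Submodule.sub_mem _ hxx' hyy')
  rw [vsub_eq_sub] at ha hb
  have hsum : b • w = a • u + t • v := by
    rw [ha, hb, ht]
    abel
  have hsin := sin_angle_ne_zero_of_notMem hw hv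
  have key := norm_mul_sin_angle_add_smul (a • u) hv0 t
  rw [← hsum, norm_smul_mul_sin_angle_smul, norm_smul_mul_sin_angle_smul] at key
  rw [dist_eq_norm, dist_eq_norm, ← ha, ← hb]
  field_simp
  linarith
end

section
/- Let δ, θ be real numbers with 0 < δ < π/2 and 0 < θ ≤ π/2, and set c = Real.sin (π - δ - θ) / Real.sin θ. Then c ≥ 0, and the following trichotomy holds: c > 1 if and only if θ < (π - δ)/2; c = 1 if and only if θ = (π - δ)/2; and c < 1 if and only if (π - δ)/2 < θ. -/
/-- Sections 2.1 and 4 of the paper: classification of the similarity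
coefficient `c = sin(π - δ - θ)/sin θ` of a rule mapping away from the
intersection point of two lines meeting at acute angle `δ`. -/
theorem similarity_coefficient_trichotomy_away
    (δ θ : ℝ) (hδ0 : 0 < δ) (hδ : δ < Real.pi / 2)
    (hθ0 : 0 < θ) (hθ : θ ≤ Real.pi / 2) :
    0 ≤ Real.sin (Real.pi - δ - θ) / Real.sin θ ∧
    (1 < Real.sin (Real.pi - δ - θ) / Real.sin θ ↔ θ < (Real.pi - δ) / 2) ∧
    (Real.sin (Real.pi - δ - θ) / Real.sin θ = 1 ↔ θ = (Real.pi - δ) / 2) ∧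
    (Real.sin (Real.pi - δ - θ) / Real.sin θ < 1 ↔ (Real.pi - δ) / 2 < θ) := by
  have hsin : 0 < Real.sin θ := Real.sin_pos_of_pos_of_lt_pi hθ0 (by linarith)
  have hcos : 0 < Real.cos ((Real.pi - δ - θ + θ) / 2) :=
    Real.cos_pos_of_mem_Ioo ⟨by linarith, by linarith⟩
  have hsub := Real.sin_sub_sin (Real.pi - δ - θ) θ
  refine ⟨div_nonneg (Real.sin_nonneg_of_nonneg_of_le_pi (by linarith) (by linarith)) hsin.le, ?_⟩
  rw [one_lt_div hsin, div_eq_one_iff_eq hsin.ne', div_lt_one hsin]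
  rcases lt_trichotomy θ ((Real.pi - δ) / 2) with h | h | h
  · have hpos : 0 < Real.sin ((Real.pi - δ - θ - θ) / 2) :=
      Real.sin_pos_of_pos_of_lt_pi (by linarith) (by linarith)
    have hlt : Real.sin θ < Real.sin (Real.pi - δ - θ) := by
      linarith [mul_pos (mul_pos two_pos hpos) hcos]
    simp [h, h.ne, h.not_gt, hlt, hlt.ne', hlt.not_gt]
  · have heq : Real.pi - δ - θ = θ := by linarith
    rw [heq]
    simp [← h]
  · have hneg : Real.sin ((Real.pi - δ - θ - θ) / 2) < 0 :=
      Real.sin_neg_of_neg_of_neg_pi_lt (by linarith) (by linarith)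
    have hlt : Real.sin (Real.pi - δ - θ) < Real.sin θ := by
      linarith [mul_neg_of_neg_of_pos (mul_neg_of_pos_of_neg two_pos hneg) hcos]
    simp [h, h.ne', h.not_gt, hlt, hlt.ne, hlt.not_gt]
end

section
/- Let δ, θ be real numbers with 0 < δ ≤ π/2 and 0 < θ ≤ π/2, and set c = |Real.sin (θ - δ)| / Real.sin θ. Then the following trichotomy holds: c > 1 if and only if θ < δ/2; c = 1 if and only if θ = δ/2; and c < 1 if and only if δ/2 < θ. -/
/-- Section 2.1 of the paper: classification of the similarity coefficient
`c = |sin(θ - δ)|/sin θ` of a rule mapping toward the intersection point of two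
lines meeting at acute or right angle `δ`. -/
theorem similarity_coefficient_trichotomy_toward
    (δ θ : ℝ) (hδ0 : 0 < δ) (hδ : δ ≤ Real.pi / 2)
    (hθ0 : 0 < θ) (hθ : θ ≤ Real.pi / 2) :
    (1 < |Real.sin (θ - δ)| / Real.sin θ ↔ θ < δ / 2) ∧
    (|Real.sin (θ - δ)| / Real.sin θ = 1 ↔ θ = δ / 2) ∧
    (|Real.sin (θ - δ)| / Real.sin θ < 1 ↔ δ / 2 < θ) := by
  have hsin : 0 < Real.sin θ := Real.sin_pos_of_pos_of_lt_pi hθ0 (by linarith)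
  have habs : |θ - δ| ≤ Real.pi / 2 := abs_le.2 ⟨by linarith, by linarith⟩
  have hmem : |θ - δ| ∈ Set.Icc (-(Real.pi / 2)) (Real.pi / 2) :=
    ⟨by linarith [abs_nonneg (θ - δ)], habs⟩
  have hθmem : θ ∈ Set.Icc (-(Real.pi / 2)) (Real.pi / 2) := ⟨by linarith, hθ⟩
  rw [Real.abs_sin_eq_sin_abs_of_abs_le_pi (by linarith), one_lt_div hsin,
    div_eq_one_iff_eq hsin.ne', div_lt_one hsin, Real.strictMonoOn_sin.lt_iff_lt hθmem hmem,
    Real.strictMonoOn_sin.lt_iff_lt hmem hθmem, Real.injOn_sin.eq_iff hmem hθmem]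
  grind
end

section
/- Let δ, θ₁, θ₂ be real numbers with 0 < δ < π/2, 0 < θ₁ ≤ π/2, and 0 < θ₂ ≤ π/2. Set c₁ = Real.sin (π - θ₁ - δ) / Real.sin θ₁ and c₂ = Real.sin (π - θ₂ - δ) / Real.sin θ₂. Then 0 ≤ c₁ * c₂, and c₁ * c₂ < 1 if and only if (π - δ)/2 < (θ₁ + θ₂)/2 and (θ₁ + θ₂)/2 ≤ π/2. Equivalently: Real.sin (π - θ₁ - δ) * Real.sin (π - θ₂ - δ) < Real.sin θ₁ * Real.sin θ₂ if and only if π - δ < θ₁ + θ₂. -/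
theorem Real.sin_add_mul_sin_add_sub (x y d : ℝ) :
    Real.sin (x + d) * Real.sin (y + d) - Real.sin x * Real.sin y =
      Real.sin (x + y + d) * Real.sin d := by
  simp only [Real.sin_add, Real.cos_add]
  linear_combination (Real.sin x * Real.sin y) * Real.sin_sq_add_cos_sq d

theorem Real.sin_neg_iff_pi_lt {x : ℝ} (hx0 : 0 ≤ x) (hx : x < 2 * Real.pi) :
    Real.sin x < 0 ↔ Real.pi < x := by
  refine ⟨fun h => ?_, fun h => ?_⟩
  · by_contra! hle
    exact h.not_ge (Real.sin_nonneg_of_nonneg_of_le_pi hx0 hle)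
  · have := Real.sin_pos_of_pos_of_lt_pi (sub_pos.2 h) (by linarith)
    rwa [Real.sin_sub_pi, neg_pos] at this

/-- Lemma 7 of the paper: the composition of two rules with separation
coefficients `c₁ = sin(π - θ₁ - δ)/sin θ₁` and `c₂ = sin(π - θ₂ - δ)/sin θ₂`
is a contraction exactly when the average projection angle `(θ₁ + θ₂)/2` lies
in `((π - δ)/2, π/2]`. -/
theorem average_contraction_condition_iff
    (δ θ₁ θ₂ : ℝ) (hδ0 : 0 < δ) (hδ : δ < Real.pi / 2)
    (h₁0 : 0 < θ₁) (h₁ : θ₁ ≤ Real.pi / 2)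
    (h₂0 : 0 < θ₂) (h₂ : θ₂ ≤ Real.pi / 2) :
    0 ≤ (Real.sin (Real.pi - θ₁ - δ) / Real.sin θ₁) *
        (Real.sin (Real.pi - θ₂ - δ) / Real.sin θ₂) ∧
    ((Real.sin (Real.pi - θ₁ - δ) / Real.sin θ₁) *
        (Real.sin (Real.pi - θ₂ - δ) / Real.sin θ₂) < 1 ↔
      (Real.pi - δ) / 2 < (θ₁ + θ₂) / 2 ∧ (θ₁ + θ₂) / 2 ≤ Real.pi / 2) ∧
    (Real.sin (Real.pi - θ₁ - δ) * Real.sin (Real.pi - θ₂ - δ) <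
        Real.sin θ₁ * Real.sin θ₂ ↔ Real.pi - δ < θ₁ + θ₂) := by
  have hsin (θ : ℝ) : Real.sin (Real.pi - θ - δ) = Real.sin (θ + δ) := by
    rw [sub_sub, Real.sin_pi_sub]
  have hs₁ : 0 < Real.sin θ₁ := Real.sin_pos_of_pos_of_lt_pi h₁0 (by linarith)
  have hs₂ : 0 < Real.sin θ₂ := Real.sin_pos_of_pos_of_lt_pi h₂0 (by linarith)
  have hsδ : 0 < Real.sin δ := Real.sin_pos_of_pos_of_lt_pi hδ0 (by linarith)
  have hn₁ : 0 ≤ Real.sin (θ₁ + δ) :=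
    Real.sin_nonneg_of_nonneg_of_le_pi (by linarith) (by linarith)
  have hn₂ : 0 ≤ Real.sin (θ₂ + δ) :=
    Real.sin_nonneg_of_nonneg_of_le_pi (by linarith) (by linarith)
  have key : Real.sin (θ₁ + δ) * Real.sin (θ₂ + δ) < Real.sin θ₁ * Real.sin θ₂ ↔
      Real.pi - δ < θ₁ + θ₂ := by
    rw [← sub_neg, Real.sin_add_mul_sin_add_sub, ← neg_pos, ← neg_mul,
      mul_pos_iff_of_pos_right hsδ, neg_pos,
      Real.sin_neg_iff_pi_lt (by linarith) (by linarith), sub_lt_iff_lt_add]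
  rw [hsin, hsin]
  refine ⟨by positivity, ?_, key⟩
  rw [div_mul_div_comm, div_lt_one (mul_pos hs₁ hs₂), key]
  exact ⟨fun h => ⟨by linarith, by linarith⟩, fun h => by linarith [h.1]⟩
end

section
/- Let X be a nonempty complete metric space, F : X → X a function, ι a finite type, and P : ι → Set X a family of subsets of X such that each P i is nonempty and closed. Assume: (a) for every i there exists j with F '' (P i) ⊆ P j; and (b) there exists C with 0 ≤ C < 1 such that for every i and all x, y ∈ P i, dist (F x) (F y) ≤ C * dist x y. Then for every x ∈ ⋃ i, P i, there exist natural numbers s and k with k > 0 and a point p ∈ X such that F^[k] p = p and the sequence j ↦ F^[s + j * k] x converges to p. In particular, the orbit of x under F converges to a periodic orbit of F of period dividing k. -/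
theorem mapsTo_iterate_piece {X ι : Type*} {F : X → X} {P : ι → Set X} {g : ι → ι}
    (hg : ∀ i, Set.MapsTo F (P i) (P (g i))) (n : ℕ) (i : ι) :
    Set.MapsTo F^[n] (P i) (P (g^[n] i)) := by
  induction n generalizing i with
  | zero => exact Set.mapsTo_id _
  | succ n ih => exact (ih (g i)).comp (hg i)

theorem lipschitzOnWith_iterate_piece {X ι : Type*} [PseudoEMetricSpace X] {F : X → X}
    {P : ι → Set X} {g : ι → ι} {K : NNReal} (hg : ∀ i, Set.MapsTo F (P i) (P (g i)))
    (hF : ∀ i, LipschitzOnWith K F (P i)) (n : ℕ) (i : ι) :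
    LipschitzOnWith (K ^ n) F^[n] (P i) := by
  induction n generalizing i with
  | zero => simpa using LipschitzWith.id.lipschitzOnWith
  | succ n ih => simpa only [pow_succ, Function.iterate_succ] using (ih (g i)).comp (hF i) (hg i)

/-- Abstract form of Theorem 3 of the paper: a piecewise contraction whose
pieces are finitely many nonempty closed sets, each mapped into some piece,
has all orbits (starting in the union of the pieces) converging to a periodic
orbit. -/
theorem orbit_tendsto_periodic_of_piecewise_contraction
    {X : Type*} [MetricSpace X] [CompleteSpace X] [Nonempty X]
    (F : X → X) {ι : Type*} [Finite ι] (P : ι → Set X)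
    (hne : ∀ i, (P i).Nonempty) (hcl : ∀ i, IsClosed (P i))
    (hmaps : ∀ i, ∃ j, F '' P i ⊆ P j)
    (C : ℝ) (hC0 : 0 ≤ C) (hC1 : C < 1)
    (hcontr : ∀ i, ∀ x ∈ P i, ∀ y ∈ P i, dist (F x) (F y) ≤ C * dist x y) :
    ∀ x ∈ ⋃ i, P i, ∃ s k : ℕ, 0 < k ∧ ∃ p : X, F^[k] p = p ∧
      Filter.Tendsto (fun j : ℕ => F^[s + j * k] x) Filter.atTop (nhds p) := by
  intro x hx
  obtain ⟨i, hi⟩ := Set.mem_iUnion.1 hx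
  choose g hg using hmaps
  replace hg : ∀ i, Set.MapsTo F (P i) (P (g i)) := fun i => Set.mapsTo_iff_image_subset.2 (hg i)
  lift C to NNReal using hC0
  have hlip : ∀ i, LipschitzOnWith C F (P i) := fun i => LipschitzOnWith.of_dist_le_mul (hcontr i)
  obtain ⟨m, n, hmn, heq⟩ : ∃ m n, m < n ∧ g^[m] i = g^[n] i := by
    obtain ⟨m, n, hne, heq⟩ := Finite.exists_ne_map_eq_of_infinite fun n : ℕ => g^[n] i
    rcases hne.lt_or_gt with h | h
    · exact ⟨m, n, h, heq⟩
    · exact ⟨n, m, h, heq.symm⟩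
  obtain ⟨k, rfl⟩ := Nat.exists_eq_add_of_le hmn.le
  have hk : 0 < k := by omega
  have hper : g^[k] (g^[m] i) = g^[m] i := by
    rw [← Function.iterate_add_apply, Nat.add_comm, ← heq]
  have hself : Set.MapsTo F^[k] (P (g^[m] i)) (P (g^[m] i)) := by
    simpa only [hper] using mapsTo_iterate_piece hg k (g^[m] i)
  have hcontracting : ContractingWith (C ^ k) (hself.restrict F^[k] _ _) :=
    ⟨pow_lt_one₀ zero_le (by exact_mod_cast hC1) hk.ne',
      (lipschitzOnWith_iterate_piece hg hlip k _).mapsToRestrict hself⟩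
  obtain ⟨p, -, hp, hlim, -⟩ := hcontracting.exists_fixedPoint' (hcl _).isComplete hself
    (mapsTo_iterate_piece hg m i hi) (edist_ne_top _ _)
  refine ⟨m, k, hk, p, hp, hlim.congr fun j => ?_⟩
  rw [← Function.iterate_mul, ← Function.iterate_add_apply, Nat.mul_comm, Nat.add_comm]
end

section
/- Let α be a type, F : α → α a function, ι a finite type, and P : ι → Set α a family of subsets such that for every i there exists j with F '' (P i) ⊆ P j. Then for every x ∈ ⋃ i, P i, there exist an index i and natural numbers s, k with k > 0 such that F^[s] x ∈ P i and F^[k] '' (P i) ⊆ P i. -/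
/-- If `F` maps each `P i` into `P (g i)`, then `F^[n]` maps `P i` into `P (g^[n] i)`. -/
theorem mapsTo_iterate_of_forall_mapsTo {α ι : Type*} {F : α → α} {P : ι → Set α} {g : ι → ι}
    (h : ∀ i, Set.MapsTo F (P i) (P (g i))) (n : ℕ) (i : ι) :
    Set.MapsTo F^[n] (P i) (P (g^[n] i)) := by
  induction n generalizing i with
  | zero => exact Set.mapsTo_id _
  | succ n ih => exact (ih (g i)).comp (h i)

/-- Abstract pigeonhole content of Lemma 4 of the paper: if each of finitely
many sets is mapped by `F` into some set of the family, then every orbit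
starting in the union enters a confining set, i.e. a set `P i` with
`F^[k] '' P i ⊆ P i` for some `k > 0`. -/
theorem exists_confining_set
    {α : Type*} (F : α → α) {ι : Type*} [Finite ι] (P : ι → Set α)
    (hmaps : ∀ i, ∃ j, F '' P i ⊆ P j) :
    ∀ x ∈ ⋃ i, P i, ∃ (i : ι) (s k : ℕ), 0 < k ∧
      F^[s] x ∈ P i ∧ F^[k] '' P i ⊆ P i := by
  intro x hx
  obtain ⟨i, hi⟩ := Set.mem_iUnion.mp hx
  choose g hg using hmaps
  have hiter := mapsTo_iterate_of_forall_mapsTo fun i => Set.mapsTo_iff_image_subset.mpr (hg i)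
  obtain ⟨m, n, hmn, heq⟩ : ∃ m n, m < n ∧ g^[m] i = g^[n] i := by
    obtain ⟨m, n, hne, heq⟩ := Finite.exists_ne_map_eq_of_infinite fun n => g^[n] i
    rcases hne.lt_or_gt with h | h
    exacts [⟨m, n, h, heq⟩, ⟨n, m, h, heq.symm⟩]
  have hper : g^[n - m] (g^[m] i) = g^[m] i := by
    rw [← Function.iterate_add_apply, Nat.sub_add_cancel hmn.le, heq]
  refine ⟨g^[m] i, m, n - m, Nat.sub_pos_of_lt hmn, hiter m i hi, ?_⟩
  simpa only [hper] using (hiter (n - m) (g^[m] i)).image_subset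
end
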